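/- arXiv:2203.06057 — 2 statements merged into one kernel-verified Lean document; each statement's English description precedes it below -/
import Mathlib

section
/- Let λ be a Lévy measure on (0,∞) with m_{2/d}(λ) = ∫_{(0,∞)} z^{2/d} λ(dz) < ∞. Then τ̄(r) ~ (2πκ)^{-1} m_{2/d}(λ) r^{-2/d} as r → ∞. -/
open MeasureTheory Real Filter Set
open scoped ENNReal Topology

noncomputable section

/-- The heat kernel on `ℝ^d` with diffusion constant `κ`. -/
def heatKernel (d : ℕ) (κ : ℝ) (s : ℝ) (x : EuclideanSpace ℝ (Fin d)) : ℝ :=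
  (2 * π * κ * s) ^ (-(d : ℝ) / 2) * Real.exp (-‖x‖ ^ 2 / (2 * κ * s))

/-- A Lévy measure on `(0,∞)`: a nonzero Borel measure carried by `(0,∞)`
with `∫ min(1, z²) λ(dz) < ∞`. -/
def IsLevyMeasure (lam : Measure ℝ) : Prop :=
  lam ≠ 0 ∧ lam (Set.Iic 0) = 0 ∧
    ∫⁻ z in Set.Ioi (0 : ℝ), ENNReal.ofReal (min 1 (z ^ 2)) ∂lam < ⊤

/-- `η̄(r) = (Leb ⊗ Leb ⊗ λ)({(s,y,z) ∈ (0,t] × ℝ^d × (0,∞) : g(s,y) z > r})`. -/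
def etaBar (d : ℕ) (κ t : ℝ) (lam : Measure ℝ) (r : ℝ) : ℝ≥0∞ :=
  (volume.prod (volume.prod lam))
    {p : ℝ × (EuclideanSpace ℝ (Fin d)) × ℝ |
      p.1 ∈ Set.Ioc (0 : ℝ) t ∧ p.2.2 ∈ Set.Ioi (0 : ℝ) ∧
        r < heatKernel d κ p.1 p.2.1 * p.2.2}

/-- `η̄₀(r)`, the analogue of `η̄` with the restriction `|y| ≤ 1/2`. -/
def etaBar0 (d : ℕ) (κ t : ℝ) (lam : Measure ℝ) (r : ℝ) : ℝ≥0∞ :=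
  (volume.prod (volume.prod lam))
    {p : ℝ × (EuclideanSpace ℝ (Fin d)) × ℝ |
      p.1 ∈ Set.Ioc (0 : ℝ) t ∧ p.2.2 ∈ Set.Ioi (0 : ℝ) ∧ ‖p.2.1‖ ≤ 1 / 2 ∧
        r < heatKernel d κ p.1 p.2.1 * p.2.2}

/-- `η̄_A(r)`, where the heat kernel is evaluated at `dist(y, A)`. -/
def etaBarA (d : ℕ) (κ t : ℝ) (lam : Measure ℝ)
    (A : Set (EuclideanSpace ℝ (Fin d))) (r : ℝ) : ℝ≥0∞ :=
  (volume.prod (volume.prod lam))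
    {p : ℝ × (EuclideanSpace ℝ (Fin d)) × ℝ |
      p.1 ∈ Set.Ioc (0 : ℝ) t ∧ p.2.2 ∈ Set.Ioi (0 : ℝ) ∧
        r < (2 * π * κ * p.1) ^ (-(d : ℝ) / 2) *
            Real.exp (-(Metric.infDist p.2.1 A) ^ 2 / (2 * κ * p.1)) * p.2.2}

/-- `τ̄(r) = (Leb ⊗ λ)({(s,z) ∈ (0,t] × (0,∞) : (2πκs)^{-d/2} z > r})`. -/
def tauBar (d : ℕ) (κ t : ℝ) (lam : Measure ℝ) (r : ℝ) : ℝ≥0∞ :=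
  (volume.prod lam)
    {p : ℝ × ℝ | p.1 ∈ Set.Ioc (0 : ℝ) t ∧ p.2 ∈ Set.Ioi (0 : ℝ) ∧
      r < (2 * π * κ * p.1) ^ (-(d : ℝ) / 2) * p.2}

/-- The truncated moment `M_γ(x) = ∫_{(0,x]} z^γ λ(dz)`. -/
def Mgamma (lam : Measure ℝ) (γ x : ℝ) : ℝ≥0∞ :=
  ∫⁻ z in Set.Ioc (0 : ℝ) x, ENNReal.ofReal (z ^ γ) ∂lam

/-- A measurable function, positive on `[1,∞)`, is slowly varying at infinity if
`ℓ(cx)/ℓ(x) → 1` as `x → ∞` for every `c > 0`. -/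
def SlowlyVarying (ℓ : ℝ → ℝ) : Prop :=
  Measurable ℓ ∧ (∀ x ≥ (1 : ℝ), 0 < ℓ x) ∧
    ∀ c > (0 : ℝ), Tendsto (fun x => ℓ (c * x) / ℓ x) atTop (𝓝 1)

/-- Regular variation at infinity with index `-α`: `f` is eventually positive and
`f(cr)/f(r) → c^{-α}` as `r → ∞` for every `c > 0`. -/
def RegVaryNeg (f : ℝ → ℝ) (α : ℝ) : Prop :=
  (∀ᶠ r in atTop, 0 < f r) ∧
    ∀ c > (0 : ℝ), Tendsto (fun r => f (c * r) / f r) atTop (𝓝 (c ^ (-α)))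

/-- Condition (E): the necessary and sufficient condition for existence of the solution. -/
def ConditionE (d : ℕ) (lam : Measure ℝ) : Prop :=
  (∫⁻ z in Set.Ioi (1 : ℝ), ENNReal.ofReal (Real.log z ^ ((d : ℝ) / 2)) ∂lam < ⊤) ∧
  (d = 1 → ∫⁻ z in Set.Ioc (0 : ℝ) 1, ENNReal.ofReal (z ^ 2) ∂lam < ⊤) ∧
  (d = 2 → ∫⁻ z in Set.Ioc (0 : ℝ) 1, ENNReal.ofReal (z ^ 2 * |Real.log z|) ∂lam < ⊤) ∧
  (3 ≤ d → ∫⁻ z in Set.Ioc (0 : ℝ) 1, ENNReal.ofReal (z ^ (1 + 2 / (d : ℝ))) ∂lam < ⊤)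

/-- Condition (F): `∫_{(0,1)} z^{2/d} λ(dz) < ∞` if `d ≠ 2`,
and `∫_{(0,1)} z |log z| λ(dz) < ∞` if `d = 2`. -/
def ConditionF (d : ℕ) (lam : Measure ℝ) : Prop :=
  (d ≠ 2 → ∫⁻ z in Set.Ioo (0 : ℝ) 1, ENNReal.ofReal (z ^ ((2 : ℝ) / d)) ∂lam < ⊤) ∧
  (d = 2 → ∫⁻ z in Set.Ioo (0 : ℝ) 1, ENNReal.ofReal (z * |Real.log z|) ∂lam < ⊤)

/-- A measure carried by `(0,∞)` with a finite moment is s-finite. -/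
theorem sFinite_of_moment_lt_top {lam : Measure ℝ} {q : ℝ} (h0 : lam (Set.Iic 0) = 0)
    (hm : ∫⁻ z in Set.Ioi (0 : ℝ), ENNReal.ofReal (z ^ q) ∂lam < ⊤) : SFinite lam := by
  have hres : lam.restrict (Set.Ioi 0) = lam := by
    refine Measure.restrict_eq_self_of_ae_mem ?_
    rw [ae_iff]
    simpa [Set.Iic] using h0
  rw [hres] at hm
  have hpos : ∀ᵐ z ∂lam, 0 < z := by
    rw [ae_iff]
    simpa [Set.Iic] using h0
  have hmeas : Measurable fun z : ℝ => ENNReal.ofReal (z ^ q) := by fun_prop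
  have : IsFiniteMeasure (lam.withDensity fun z => ENNReal.ofReal (z ^ q)) :=
    isFiniteMeasure_withDensity hm.ne
  rw [← withDensity_inv_same (μ := lam) hmeas
    (hpos.mono fun z hz => by simpa using Real.rpow_pos_of_pos hz q)
    (ae_of_all _ fun z => ENNReal.ofReal_ne_top)]
  infer_instance

theorem lt_rpow_neg_mul_iff {a p q r s z : ℝ} (ha : 0 < a) (hp : 0 < p) (hpq : q = p⁻¹)
    (hr : 0 < r) (hs : 0 < s) (hz : 0 < z) :
    r < (a * s) ^ (-p) * z ↔ s < a⁻¹ * z ^ q * r ^ (-q) := by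
  have has : 0 < a * s := mul_pos ha hs
  have h1 : r < (a * s) ^ (-p) * z ↔ (a * s) ^ p < z / r := by
    rw [Real.rpow_neg has.le, inv_mul_eq_div, lt_div_iff₀ (Real.rpow_pos_of_pos has p),
      lt_div_iff₀ hr, mul_comm]
  rw [h1, ← Real.lt_rpow_inv_iff_of_pos has.le (div_pos hz hr).le hp, ← hpq,
    Real.div_rpow hz.le hr.le, Real.rpow_neg hr.le, mul_assoc, ← div_eq_inv_mul,
    ← div_eq_mul_inv, lt_div_iff₀ ha, mul_comm]

/-- `τ̄(r)` as a one-dimensional integral of a truncated moment. -/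
theorem tauBar_eq_lintegral {d : ℕ} (hd : 1 ≤ d) {κ t : ℝ} (hκ : 0 < κ)
    (lam : Measure ℝ) [SFinite lam] {r : ℝ} (hr : 0 < r) :
    tauBar d κ t lam r = ∫⁻ z in Set.Ioi (0 : ℝ),
      ENNReal.ofReal (min t ((2 * π * κ)⁻¹ * z ^ ((2 : ℝ) / d) * r ^ (-((2 : ℝ) / d)))) ∂lam := by
  have hd' : (0 : ℝ) < d := by exact_mod_cast hd
  have hf : Measurable fun p : ℝ × ℝ => (2 * π * κ * p.1) ^ (-(d : ℝ) / 2) * p.2 := by fun_prop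
  have hmeas : MeasurableSet {p : ℝ × ℝ | p.1 ∈ Set.Ioc (0 : ℝ) t ∧ p.2 ∈ Set.Ioi (0 : ℝ) ∧
      r < (2 * π * κ * p.1) ^ (-(d : ℝ) / 2) * p.2} :=
    (measurable_fst measurableSet_Ioc).inter ((measurable_snd measurableSet_Ioi).inter
      (measurableSet_lt measurable_const hf))
  rw [tauBar, Measure.prod_apply_symm hmeas, ← lintegral_indicator measurableSet_Ioi]
  refine lintegral_congr fun z => ?_
  by_cases hz : 0 < z
  · rw [Set.indicator_of_mem (show z ∈ Set.Ioi 0 from hz)]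
    have hset : (fun s : ℝ => (s, z)) ⁻¹' {p : ℝ × ℝ | p.1 ∈ Set.Ioc (0 : ℝ) t ∧
        p.2 ∈ Set.Ioi (0 : ℝ) ∧ r < (2 * π * κ * p.1) ^ (-(d : ℝ) / 2) * p.2} =
        Set.Ioc 0 t ∩ Set.Iio ((2 * π * κ)⁻¹ * z ^ ((2 : ℝ) / d) * r ^ (-((2 : ℝ) / d))) := by
      ext s
      simp only [Set.mem_preimage, Set.mem_ofPred_eq, Set.mem_inter_iff, Set.mem_Iio, Set.mem_Ioi]
      refine and_congr_right fun hs => ?_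
      rw [and_iff_right hz, neg_div, lt_rpow_neg_mul_iff (by positivity) (half_pos hd')
        (inv_div _ _).symm hr hs.1 hz]
    rw [hset]
    refine le_antisymm ?_ ?_
    · refine (measure_mono (t := Set.Icc 0 (min t _)) fun s hs =>
        ⟨hs.1.1.le, le_min hs.1.2 hs.2.le⟩).trans ?_
      simp
    · refine le_trans ?_ (measure_mono (s := Set.Ioo 0 (min t _)) fun s hs =>
        ⟨⟨hs.1, (hs.2.trans_le (min_le_left _ _)).le⟩, hs.2.trans_le (min_le_right _ _)⟩)
      simp
  · rw [Set.indicator_of_notMem (show z ∉ Set.Ioi 0 from hz)]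
    simp [hz]

/-- Lifting the truncation recovers the full moment. -/
theorem tendsto_lintegral_min_moment {lam : Measure ℝ} {c t q : ℝ} (hc : 0 < c) (ht : 0 < t)
    (hq : 0 < q) (hm : ∫⁻ z in Set.Ioi (0 : ℝ), ENNReal.ofReal (z ^ q) ∂lam < ⊤) :
    Tendsto (fun r : ℝ =>
        ∫⁻ z in Set.Ioi (0 : ℝ), ENNReal.ofReal (min (t * r ^ q) (c * z ^ q)) ∂lam)
      atTop (𝓝 (ENNReal.ofReal c * ∫⁻ z in Set.Ioi (0 : ℝ), ENNReal.ofReal (z ^ q) ∂lam)) := by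
  have hmeas : Measurable fun z : ℝ => ENNReal.ofReal (z ^ q) := by fun_prop
  rw [← lintegral_const_mul _ hmeas]
  simp_rw [← ENNReal.ofReal_mul hc.le]
  refine tendsto_lintegral_filter_of_dominated_convergence
    (fun z => ENNReal.ofReal (c * z ^ q)) (Eventually.of_forall fun r => by fun_prop)
    (Eventually.of_forall fun r => ae_of_all _ fun z =>
      ENNReal.ofReal_le_ofReal (min_le_right _ _)) ?_ (ae_of_all _ fun z => ?_)
  · simp_rw [ENNReal.ofReal_mul hc.le]
    rw [lintegral_const_mul _ hmeas]
    exact ENNReal.mul_ne_top ENNReal.ofReal_ne_top hm.ne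
  · refine tendsto_const_nhds.congr' ?_
    filter_upwards [((tendsto_rpow_atTop hq).const_mul_atTop ht).eventually_ge_atTop (c * z ^ q)]
      with r hr
    rw [min_eq_right hr]

/-- Lemma 3.2 (i): if `m_{2/d}(λ) < ∞` then
`τ̄(r) ~ (2πκ)^{-1} m_{2/d}(λ) r^{-2/d}` as `r → ∞`. -/
theorem stmt_11 (d : ℕ) (hd : 1 ≤ d) (κ t : ℝ) (hκ : 0 < κ) (ht : 0 < t)
    (lam : Measure ℝ) (hlam : IsLevyMeasure lam)
    (hm : ∫⁻ z in Set.Ioi (0 : ℝ), ENNReal.ofReal (z ^ ((2 : ℝ) / d)) ∂lam < ⊤) :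
    Tendsto (fun r : ℝ =>
        (tauBar d κ t lam r).toReal /
          ((2 * π * κ)⁻¹ *
            (∫⁻ z in Set.Ioi (0 : ℝ),
              ENNReal.ofReal (z ^ ((2 : ℝ) / d)) ∂lam).toReal *
            r ^ (-((2 : ℝ) / d))))
      atTop (𝓝 1) := by
  have hd' : (0 : ℝ) < d := by exact_mod_cast hd
  have hq : (0 : ℝ) < 2 / d := by positivity
  have hc : 0 < (2 * π * κ)⁻¹ := by positivity
  obtain ⟨hne, h0, -⟩ := hlam
  have := sFinite_of_moment_lt_top h0 hm
  have hm0 : ∫⁻ z in Set.Ioi (0 : ℝ), ENNReal.ofReal (z ^ ((2 : ℝ) / d)) ∂lam ≠ 0 := by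
    intro h
    rw [setLIntegral_eq_zero_iff measurableSet_Ioi (by fun_prop)] at h
    refine hne (Measure.measure_univ_eq_zero.mp ?_)
    rw [← Set.Iic_union_Ioi (a := (0 : ℝ))]
    refine measure_union_null h0 (measure_mono_null (fun z hz => ?_) (ae_iff.mp h))
    simpa [show 0 < z from hz] using Real.rpow_pos_of_pos hz _
  have hmR := ENNReal.toReal_pos hm0 hm.ne
  have hlim := (ENNReal.tendsto_toReal (ENNReal.mul_ne_top ENNReal.ofReal_ne_top hm.ne)).comp
    (tendsto_lintegral_min_moment hc ht hq hm)
  rw [ENNReal.toReal_mul, ENNReal.toReal_ofReal hc.le] at hlim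
  have hdiv := hlim.div_const ((2 * π * κ)⁻¹ *
    (∫⁻ z in Set.Ioi (0 : ℝ), ENNReal.ofReal (z ^ ((2 : ℝ) / d)) ∂lam).toReal)
  rw [div_self (mul_pos hc hmR).ne'] at hdiv
  refine hdiv.congr' ?_
  filter_upwards [eventually_gt_atTop 0] with r hr
  have hrq : 0 < r ^ ((2 : ℝ) / d) := Real.rpow_pos_of_pos hr _
  have hscale : ∫⁻ z in Set.Ioi (0 : ℝ), ENNReal.ofReal
      (min (t * r ^ ((2 : ℝ) / d)) ((2 * π * κ)⁻¹ * z ^ ((2 : ℝ) / d))) ∂lam =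
      tauBar d κ t lam r * ENNReal.ofReal (r ^ ((2 : ℝ) / d)) := by
    rw [tauBar_eq_lintegral hd hκ lam hr, ← lintegral_mul_const _ (by fun_prop)]
    refine lintegral_congr fun z => ?_
    rw [← ENNReal.ofReal_mul' hrq.le, min_mul_of_nonneg _ _ hrq.le, Real.rpow_neg hr.le,
      inv_mul_cancel_right₀ hrq.ne']
  rw [Function.comp_apply, hscale, ENNReal.toReal_mul, ENNReal.toReal_ofReal hrq.le,
    Real.rpow_neg hr.le, ← div_eq_mul_inv, div_div_eq_mul_div]
end
end

section
/- Let λ be a Lévy measure on (0,∞) satisfying Condition (F). Suppose there are α ∈ [0, 2/d] and a slowly varying function ℓ such that λ̄(r) = ℓ(r) r^{−α} for all r ≥ 1; if α = 2/d, assume additionally that ∫_1^∞ ℓ(u) u^{-1} du = ∞. Then, as r → ∞: if α < 2/d, τ̄(r) ~ (2 t D^{−α} / (2 − dα)) ℓ(r) r^{−α}; if α = 2/d, τ̄(r) ~ (2/d)(2πκ)^{-1} L(r) r^{−2/d}, where L(r) = ∫_1^r ℓ(u) u^{-1} du. -/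
open MeasureTheory Real Filter Set
open scoped ENNReal Topology

noncomputable section

/-- A Potter bound for a monotone regularly varying function of index `-a`. -/
theorem AntitoneOn.exists_potter_bound {H : ℝ → ℝ} {a b : ℝ} (hanti : AntitoneOn H (Ioi 0))
    (hpos : ∀ v > 0, 0 < H v)
    (hreg : ∀ k > 0, Tendsto (fun x => H (k * x) / H x) atTop (𝓝 (k ^ (-a))))
    (hab : a < b) (hb : 0 ≤ b) :
    ∃ X > 0, ∀ y ≥ X, ∀ x ≥ y, H y ≤ 2 ^ b * (x / y) ^ b * H x := by
  have hlt : (2 : ℝ) ^ (-b) < 2 ^ (-a) :=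
    Real.rpow_lt_rpow_of_exponent_lt (by norm_num) (by linarith)
  obtain ⟨X, hX⟩ := eventually_atTop.1 ((hreg 2 (by norm_num)).eventually_const_lt hlt)
  have hstep : ∀ z ≥ max X 1, H z ≤ 2 ^ b * H (2 * z) := by
    intro z hz
    have hz0 : 0 < z := zero_lt_one.trans_le ((le_max_right _ _).trans hz)
    have h := hX z ((le_max_left _ _).trans hz)
    rw [lt_div_iff₀ (hpos z hz0), Real.rpow_neg (by norm_num)] at h
    have h2 : (0 : ℝ) < 2 ^ b := by positivity
    calc H z = 2 ^ b * ((2 ^ b)⁻¹ * H z) := by field_simp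
      _ ≤ _ := by gcongr
  refine ⟨max X 1, by positivity, fun y hy x hx => ?_⟩
  have hy0 : 0 < y := zero_lt_one.trans_le ((le_max_right _ _).trans hy)
  have hiter : ∀ n : ℕ, H y ≤ ((2 : ℝ) ^ n) ^ b * H (2 ^ n * y) := by
    intro n
    induction n with
    | zero => simp
    | succ n ih =>
      have h1 : max X 1 ≤ 2 ^ n * y :=
        hy.le.trans (le_mul_of_one_le_left hy0.le (one_le_pow₀ (by norm_num)))
      calc H y ≤ ((2 : ℝ) ^ n) ^ b * H (2 ^ n * y) := ih
        _ ≤ ((2 : ℝ) ^ n) ^ b * (2 ^ b * H (2 * (2 ^ n * y))) := by gcongr; exact hstep _ h1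
        _ = _ := by
          rw [pow_succ, Real.mul_rpow (by positivity) (by positivity)]
          ring_nf
  obtain ⟨n, hn1, hn2⟩ := exists_nat_pow_near ((one_le_div hy0).2 hx) (one_lt_two (α := ℝ))
  have hle : x ≤ 2 ^ (n + 1) * y := ((div_lt_iff₀ hy0).1 hn2).le
  have hx0 : 0 < x := hy0.trans_le hx
  calc H y ≤ ((2 : ℝ) ^ (n + 1)) ^ b * H (2 ^ (n + 1) * y) := hiter _
    _ ≤ ((2 : ℝ) ^ (n + 1)) ^ b * H x := by
      gcongr
      exact hanti hx0 (hx0.trans_le hle) hle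
    _ = 2 ^ b * ((2 : ℝ) ^ n) ^ b * H x := by
      rw [pow_succ, Real.mul_rpow (by positivity) (by positivity)]; ring
    _ ≤ _ := by
      have := (hpos x hx0).le
      gcongr

/-- Karamata's theorem for a monotone regularly varying function of index `-a > -1`. -/
theorem AntitoneOn.tendsto_integral_div_mul_self {H : ℝ → ℝ} {a : ℝ}
    (hanti : AntitoneOn H (Ioi 0)) (hpos : ∀ v > 0, 0 < H v)
    (hint : ∀ x > 0, IntervalIntegrable H volume 0 x)
    (hreg : ∀ k > 0, Tendsto (fun x => H (k * x) / H x) atTop (𝓝 (k ^ (-a))))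
    (ha0 : 0 ≤ a) (ha1 : a < 1) :
    Tendsto (fun x => (∫ v in (0 : ℝ)..x, H v) / (x * H x)) atTop (𝓝 (1 / (1 - a))) := by
  obtain ⟨b, hab, hb1⟩ := exists_between ha1
  obtain ⟨X, hX0, hX⟩ := hanti.exists_potter_bound hpos hreg hab (ha0.trans hab.le)
  set G : ℝ → ℝ := (Ioi X).indicator H with hG
  have hGint : ∀ x > 0, IntervalIntegrable G volume 0 x := fun x hx =>
    ⟨(hint x hx).1.indicator measurableSet_Ioi, (hint x hx).2.indicator measurableSet_Ioi⟩
  have hGI : ∀ x ≥ X, ∫ v in (0 : ℝ)..x, H v = (∫ v in (0 : ℝ)..X, H v) + ∫ v in (0 : ℝ)..x, G v := by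
    intro x hx
    have hx0 := hX0.trans_le hx
    have h1 : ∫ v in (0 : ℝ)..X, G v = 0 := by
      rw [intervalIntegral.integral_congr (g := fun _ => 0)]
      · simp
      · intro v hv
        rw [uIcc_of_le hX0.le] at hv
        simp [hG, hv.2]
    have h2 : ∫ v in X..x, G v = ∫ v in X..x, H v := by
      apply intervalIntegral.integral_congr_ae
      refine Eventually.of_forall fun v hv => ?_
      rw [uIoc_of_le hx] at hv
      exact indicator_of_mem (show v ∈ Ioi X from hv.1) H
    rw [← intervalIntegral.integral_add_adjacent_intervals (hGint X hX0)
        ((hGint X hX0).symm.trans (hGint x hx0)), h1, h2, zero_add,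
      intervalIntegral.integral_add_adjacent_intervals (hint X hX0)
        ((hint X hX0).symm.trans (hint x hx0))]
  have htop : Tendsto (fun x => x * H x) atTop atTop := by
    have hc : 0 < H X * X ^ b / 2 ^ b := by have := hpos X hX0; positivity
    refine tendsto_atTop_mono' _ ?_ ((tendsto_rpow_atTop (sub_pos.2 hb1)).const_mul_atTop hc)
    filter_upwards [eventually_ge_atTop X] with x hx
    have hx0 := hX0.trans_le hx
    have h := hX X le_rfl x hx
    have hXb : 0 < X ^ b := by positivity
    have h2b : (0 : ℝ) < 2 ^ b := by positivity
    have hxb : 0 < x ^ b := by positivity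
    rw [Real.div_rpow hx0.le hX0.le] at h
    rw [Real.rpow_sub hx0, Real.rpow_one]
    calc H X * X ^ b / 2 ^ b * (x / x ^ b)
        ≤ (2 ^ b * (x ^ b / X ^ b) * H x) * X ^ b / 2 ^ b * (x / x ^ b) := by gcongr
      _ = x * H x := by field_simp
  have hlim : Tendsto (fun x => ∫ v in (0 : ℝ)..1, G (x * v) / H x) atTop
      (𝓝 (∫ v in (0 : ℝ)..1, v ^ (-a))) := by
    apply intervalIntegral.tendsto_integral_filter_of_dominated_convergence
      (fun v => 2 ^ b * v ^ (-b))
    · filter_upwards [eventually_gt_atTop 0] with x hx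
      have h := ((hGint x hx).comp_mul_left (c := x)).1.aestronglyMeasurable
      rw [zero_div, div_self hx.ne'] at h
      rw [uIoc_of_le zero_le_one]
      simpa [div_eq_mul_inv] using h.mul_const (H x)⁻¹
    · filter_upwards [eventually_gt_atTop 0] with x hx
      refine Eventually.of_forall fun v hv => ?_
      rw [uIoc_of_le zero_le_one] at hv
      have hv0 := hv.1
      have hHx := hpos x hx
      by_cases hXv : X < x * v
      · rw [hG, indicator_of_mem (show x * v ∈ Ioi X from hXv), Real.norm_of_nonneg
          (div_nonneg (hpos _ (by positivity)).le hHx.le), div_le_iff₀ hHx]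
        have h := hX (x * v) hXv.le x (mul_le_of_le_one_right hx.le hv.2)
        have h3 : x / (x * v) = v⁻¹ := by field_simp
        rwa [h3, Real.inv_rpow hv0.le, ← Real.rpow_neg hv0.le] at h
      · rw [hG, indicator_of_notMem (show x * v ∉ Ioi X from hXv), zero_div, norm_zero]
        positivity
    · exact (intervalIntegral.intervalIntegrable_rpow' (by linarith)).const_mul _
    · refine Eventually.of_forall fun v hv => ?_
      rw [uIoc_of_le zero_le_one] at hv
      refine (hreg v hv.1).congr' ?_
      filter_upwards [eventually_gt_atTop (X / v)] with x hx
      have hXv := (div_lt_iff₀ hv.1).1 hx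
      rw [hG, indicator_of_mem (show x * v ∈ Ioi X from hXv), mul_comm]
  rw [integral_rpow (Or.inl (by linarith)), Real.one_rpow, Real.zero_rpow (by linarith), sub_zero,
    neg_add_eq_sub] at hlim
  have h := (htop.const_div_atTop (∫ v in (0 : ℝ)..X, H v)).add hlim
  rw [zero_add] at h
  refine h.congr' ?_
  filter_upwards [eventually_ge_atTop X] with x hx
  have hx0 := hX0.trans_le hx
  rw [hGI x hx, intervalIntegral.integral_div,
    intervalIntegral.integral_comp_mul_left (fun u => G u) hx0.ne', mul_zero, mul_one, smul_eq_mul,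
    add_div]
  congr 1
  field_simp

/-- Karamata's theorem for a monotone regularly varying function of index `-1`. -/
theorem AntitoneOn.tendsto_integral_div_mul_self_atTop {H : ℝ → ℝ}
    (hanti : AntitoneOn H (Ioi 0)) (hpos : ∀ v > 0, 0 < H v)
    (hint : ∀ x > 0, IntervalIntegrable H volume 0 x)
    (hreg : ∀ k > 0, Tendsto (fun x => H (k * x) / H x) atTop (𝓝 (k ^ (-1 : ℝ)))) :
    Tendsto (fun x => (∫ v in (0 : ℝ)..x, H v) / (x * H x)) atTop atTop := by
  set φ : ℝ → ℝ := fun x => (∫ v in (0 : ℝ)..x, H v) / (x * H x) with hφ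
  set ρ : ℝ → ℝ := fun x => 2⁻¹ * (H (2⁻¹ * x) / H x) with hρ
  have hρ1 : Tendsto ρ atTop (𝓝 1) := by
    have h := (hreg 2⁻¹ (by norm_num)).const_mul 2⁻¹
    rwa [Real.rpow_neg_one, inv_inv, inv_mul_cancel₀ two_ne_zero] at h
  have hrec : ∀ x > 0, 1 / 2 + φ (2⁻¹ * x) * ρ x ≤ φ x := by
    intro x hx
    have hx2 : 0 < 2⁻¹ * x := by positivity
    have hle : 2⁻¹ * x ≤ x := by linarith
    have hi2 := (hint _ hx2).symm.trans (hint x hx)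
    have h1 : 2⁻¹ * x * H x ≤ ∫ v in (2⁻¹ * x)..x, H v := by
      calc 2⁻¹ * x * H x = ∫ v in (2⁻¹ * x)..x, H x := by
            rw [intervalIntegral.integral_const, smul_eq_mul]; ring
        _ ≤ _ := intervalIntegral.integral_mono_on hle intervalIntegrable_const hi2
            fun v hv => hanti (hx2.trans_le hv.1) hx hv.2
    have hHx := hpos x hx
    have hHx2 := hpos _ hx2
    have hsplit := intervalIntegral.integral_add_adjacent_intervals (hint _ hx2) hi2
    calc 1 / 2 + φ (2⁻¹ * x) * ρ x
        = ((∫ v in (0 : ℝ)..(2⁻¹ * x), H v) + 2⁻¹ * x * H x) / (x * H x) := by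
          simp only [hφ, hρ]
          generalize (∫ v in (0 : ℝ)..(2⁻¹ * x), H v) = J
          generalize H (2⁻¹ * x) = h at hHx2 ⊢
          field_simp
          ring
      _ ≤ φ x := by
          simp only [hφ]
          rw [← hsplit]
          gcongr
  have hev : ∀ n : ℕ, ∀ᶠ x in atTop, (n : ℝ) / 4 ≤ φ x := by
    intro n
    induction n with
    | zero =>
      filter_upwards [eventually_gt_atTop 0] with x hx
      have := hpos x hx
      have hI : 0 ≤ ∫ v in (0 : ℝ)..x, H v :=
        intervalIntegral.integral_nonneg_of_ae_restrict hx.le <| by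
          rw [EventuallyLE, ← restrict_Ioc_eq_restrict_Icc,
            ae_restrict_iff' measurableSet_Ioc]
          exact Eventually.of_forall fun v hv => (hpos v hv.1).le
      simp only [hφ, CharP.cast_eq_zero, zero_div]
      positivity
    | succ n ih =>
      have ht : Tendsto (fun x => 1 / 2 + (n : ℝ) / 4 * ρ x) atTop (𝓝 (1 / 2 + (n : ℝ) / 4 * 1)) :=
        (hρ1.const_mul _).const_add _
      have hlt : ((n + 1 : ℕ) : ℝ) / 4 < 1 / 2 + (n : ℝ) / 4 * 1 := by push_cast; linarith
      have htwo : Tendsto (fun x : ℝ => 2⁻¹ * x) atTop atTop :=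
        tendsto_id.const_mul_atTop (by norm_num)
      filter_upwards [ht.eventually_const_lt hlt, htwo.eventually ih, eventually_gt_atTop 0]
        with x h1 h2 hx
      have hρ0 : 0 ≤ ρ x := by
        have := hpos x hx
        have := hpos (2⁻¹ * x) (by positivity)
        simp only [hρ]
        positivity
      calc _ ≤ 1 / 2 + (n : ℝ) / 4 * ρ x := h1.le
        _ ≤ 1 / 2 + φ (2⁻¹ * x) * ρ x := by gcongr
        _ ≤ _ := hrec x hx
  refine tendsto_atTop.2 fun C => ?_
  obtain ⟨n, hn⟩ := exists_nat_gt (4 * C)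
  filter_upwards [hev n] with x hx
  linarith

/-- The primitive of a monotone regularly varying function of index `-1` is slowly varying. -/
theorem AntitoneOn.tendsto_integral_mul_div_integral {H : ℝ → ℝ}
    (hanti : AntitoneOn H (Ioi 0)) (hpos : ∀ v > 0, 0 < H v)
    (hint : ∀ x > 0, IntervalIntegrable H volume 0 x)
    (hreg : ∀ k > 0, Tendsto (fun x => H (k * x) / H x) atTop (𝓝 (k ^ (-1 : ℝ))))
    {k : ℝ} (hk : 0 < k) :
    Tendsto (fun x => (∫ v in (0 : ℝ)..k * x, H v) / ∫ v in (0 : ℝ)..x, H v) atTop (𝓝 1) := by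
  have hphi := hanti.tendsto_integral_div_mul_self_atTop hpos hint hreg
  wlog hk1 : 1 ≤ k generalizing k
  · have h := (this (inv_pos.2 hk) ((one_le_inv₀ hk).2 (not_le.1 hk1).le)).comp
      (tendsto_id.const_mul_atTop hk)
    have h' := h.inv₀ one_ne_zero
    rw [inv_one] at h'
    refine h'.congr fun x => ?_
    simp only [Function.comp_apply, id, inv_div, inv_mul_cancel_left₀ hk.ne']
  have hub : Tendsto (fun x => 1 + (k - 1) * ((∫ v in (0 : ℝ)..x, H v) / (x * H x))⁻¹)
      atTop (𝓝 1) := by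
    simpa using (hphi.inv_tendsto_atTop.const_mul (k - 1)).const_add 1
  refine tendsto_of_tendsto_of_tendsto_of_le_of_le' tendsto_const_nhds hub ?_ ?_
  all_goals
    filter_upwards [eventually_gt_atTop 0, hphi.eventually_gt_atTop 0] with x hx hφ
    have hHx := hpos x hx
    have hI : 0 < ∫ v in (0 : ℝ)..x, H v := by
      have := mul_pos hφ (mul_pos hx hHx)
      rwa [div_mul_cancel₀ _ (mul_pos hx hHx).ne'] at this
    have hkx : x ≤ k * x := le_mul_of_one_le_left hx.le hk1
    have hi2 := (hint _ hx).symm.trans (hint _ (hx.trans_le hkx))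
    have hsplit := intervalIntegral.integral_add_adjacent_intervals (hint _ hx) hi2
    rw [← hsplit]
  · rw [one_le_div hI]
    exact le_add_of_nonneg_right (intervalIntegral.integral_nonneg hkx
      fun v hv => (hpos v (hx.trans_le hv.1)).le)
  · have h1 : ∫ v in x..k * x, H v ≤ (k - 1) * (x * H x) := by
      calc _ ≤ ∫ v in x..k * x, H x :=
            intervalIntegral.integral_mono_on hkx hi2 intervalIntegrable_const
              fun v hv => hanti hx (hx.trans_le hv.1) hv.1
        _ = _ := by rw [intervalIntegral.integral_const, smul_eq_mul]; ring
    rw [add_div, div_self hI.ne', inv_div, ← mul_div_assoc]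
    gcongr

theorem IsLevyMeasure.measure_Ici_lt_top {lam : Measure ℝ} (h : IsLevyMeasure lam) {ε : ℝ}
    (hε : 0 < ε) : lam (Ici ε) < ⊤ := by
  have hc : 0 < min 1 (ε ^ 2) := lt_min one_pos (by positivity)
  have hsub : Ici ε ⊆ Ioi 0 := fun z hz => hε.trans_le hz
  have hle : ENNReal.ofReal (min 1 (ε ^ 2)) * lam (Ici ε) ≤
      ∫⁻ z in Ioi (0 : ℝ), ENNReal.ofReal (min 1 (z ^ 2)) ∂lam := by
    calc _ = ∫⁻ _ in Ici ε, ENNReal.ofReal (min 1 (ε ^ 2)) ∂lam := by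
          rw [setLIntegral_const]
      _ ≤ ∫⁻ z in Ici ε, ENNReal.ofReal (min 1 (z ^ 2)) ∂lam := by
          refine setLIntegral_mono' measurableSet_Ici fun z hz => ?_
          have : ε ≤ z := hz
          gcongr
      _ ≤ _ := lintegral_mono_set hsub
  by_contra hcon
  rw [not_lt_top_iff.1 hcon, ENNReal.mul_top (ENNReal.ofReal_pos.2 hc).ne', top_le_iff] at hle
  exact h.2.2.ne hle

theorem IsLevyMeasure.measure_Ioi_lt_top {lam : Measure ℝ} (h : IsLevyMeasure lam) {ε : ℝ}
    (hε : 0 < ε) : lam (Ioi ε) < ⊤ :=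
  (measure_mono Ioi_subset_Ici_self).trans_lt (h.measure_Ici_lt_top hε)

theorem IsLevyMeasure.sigmaFinite {lam : Measure ℝ} (h : IsLevyMeasure lam) : SigmaFinite lam := by
  refine ⟨⟨⟨fun n => Iic 0 ∪ Ici (1 / ((n : ℝ) + 1)), fun _ => trivial, fun n => ?_, ?_⟩⟩⟩
  · refine (measure_union_le _ _).trans_lt ?_
    rw [h.2.1, zero_add]
    exact h.measure_Ici_lt_top (by positivity)
  · refine eq_univ_of_forall fun z => mem_iUnion.2 ?_
    rcases le_or_gt z 0 with hz | hz
    · exact ⟨0, Or.inl hz⟩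
    · obtain ⟨n, hn⟩ := exists_nat_one_div_lt hz
      exact ⟨n, Or.inr hn.le⟩

theorem ConditionF.lintegral_rpow_lt_top {d : ℕ} {lam : Measure ℝ} (hF : ConditionF d lam)
    (h : IsLevyMeasure lam) :
    ∫⁻ z in Ioo (0 : ℝ) 1, ENNReal.ofReal (z ^ ((2 : ℝ) / d)) ∂lam < ⊤ := by
  by_cases hd : d = 2
  · subst hd
    have hexp : 0 < Real.exp (-1) := Real.exp_pos _
    have hcover : Ioo (0 : ℝ) 1 ⊆ Ioo 0 1 ∩ Iio (Real.exp (-1)) ∪ Ico (Real.exp (-1)) 1 := by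
      intro z hz
      rcases lt_or_ge z (Real.exp (-1)) with h1 | h1
      · exact Or.inl ⟨hz, h1⟩
      · exact Or.inr ⟨h1, hz.2⟩
    refine (lintegral_mono_set hcover).trans_lt ((lintegral_union_le _ _ _).trans_lt ?_)
    refine ENNReal.add_lt_top.2 ⟨?_, ?_⟩
    · refine lt_of_le_of_lt ?_ (hF.2 rfl)
      refine (setLIntegral_mono' (measurableSet_Ioo.inter measurableSet_Iio) ?_).trans
        (lintegral_mono_set inter_subset_left)
      intro z hz
      refine ENNReal.ofReal_le_ofReal ?_
      have hlog : Real.log z < -1 := (Real.log_lt_iff_lt_exp hz.1.1).2 hz.2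
      have habs : 1 ≤ |Real.log z| := by rw [abs_of_neg (by linarith)]; linarith
      simpa using mul_le_mul_of_nonneg_left habs hz.1.1.le
    · calc _ ≤ ∫⁻ _ in Ico (Real.exp (-1)) 1, 1 ∂lam := by
            refine setLIntegral_mono' measurableSet_Ico fun z hz => ?_
            rw [ENNReal.ofReal_le_one]
            exact Real.rpow_le_one (hexp.le.trans hz.1) hz.2.le (by positivity)
        _ ≤ lam (Ici (Real.exp (-1))) := by
            rw [setLIntegral_one]; exact measure_mono Ico_subset_Ici_self
        _ < ⊤ := h.measure_Ici_lt_top hexp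
  · exact hF.1 hd

/-- The tail of `lam` is integrable near the origin in the time variable. -/
theorem ConditionF.lintegral_tail_lt_top {d : ℕ} (hd : 1 ≤ d) {lam : Measure ℝ}
    (hF : ConditionF d lam) (h : IsLevyMeasure lam) :
    ∫⁻ s in Ioc (0 : ℝ) 1, lam (Ioi (s ^ ((d : ℝ) / 2))) < ⊤ := by
  have := h.sigmaFinite
  have hq : 0 < (d : ℝ) / 2 := by positivity
  have hmeas : MeasurableSet {p : ℝ × ℝ | p.1 ∈ Ioc (0 : ℝ) 1 ∧ p.1 ^ ((d : ℝ) / 2) < p.2} :=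
    (measurable_fst measurableSet_Ioc).inter
      (measurableSet_lt (measurable_fst.pow_const _) measurable_snd)
  have hswap : ∫⁻ s in Ioc (0 : ℝ) 1, lam (Ioi (s ^ ((d : ℝ) / 2))) =
      ∫⁻ z, volume {s : ℝ | s ∈ Ioc (0 : ℝ) 1 ∧ s ^ ((d : ℝ) / 2) < z} ∂lam := by
    refine Eq.trans ?_ ((Measure.prod_apply (μ := volume) (ν := lam) hmeas).symm.trans
      (Measure.prod_apply_symm hmeas))
    rw [← lintegral_indicator measurableSet_Ioc]
    congr 1 with s
    by_cases hs : s ∈ Ioc (0 : ℝ) 1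
    · rw [indicator_of_mem hs]
      congr 1 with z
      simp only [mem_Ioi, mem_preimage, mem_ofPred_eq, hs, true_and]
    · rw [indicator_of_notMem hs]
      simp only [preimage_ofPred_eq, hs, false_and, ofPred_false, measure_empty]
  have hcover : (univ : Set ℝ) ⊆ Iic 0 ∪ (Ioo 0 1 ∪ Ici 1) := by
    intro z _
    rcases le_or_gt z 0 with h0 | h0
    · exact Or.inl h0
    · rcases lt_or_ge z 1 with h1 | h1
      · exact Or.inr (Or.inl ⟨h0, h1⟩)
      · exact Or.inr (Or.inr h1)
  rw [hswap, ← setLIntegral_univ]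
  refine (lintegral_mono_set hcover).trans_lt ((lintegral_union_le _ _ _).trans_lt ?_)
  rw [setLIntegral_measure_zero _ _ h.2.1, zero_add]
  refine (lintegral_union_le _ _ _).trans_lt (ENNReal.add_lt_top.2 ⟨?_, ?_⟩)
  · refine lt_of_le_of_lt ?_ (hF.lintegral_rpow_lt_top h)
    refine setLIntegral_mono' measurableSet_Ioo fun z hz => ?_
    calc _ ≤ volume (Ioc 0 (z ^ ((2 : ℝ) / d))) := by
          refine measure_mono fun s hs => ⟨hs.1.1, ?_⟩
          have := (Real.lt_rpow_inv_iff_of_pos hs.1.1.le hz.1.le hq).2 hs.2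
          rw [inv_div] at this
          exact this.le
      _ = _ := by rw [Real.volume_Ioc, sub_zero]
  · calc _ ≤ ∫⁻ _ in Ici (1 : ℝ), 1 ∂lam := by
          refine lintegral_mono fun z => ?_
          calc _ ≤ volume (Ioc (0 : ℝ) 1) := measure_mono fun s hs => hs.1
            _ = 1 := by simp
      _ = lam (Ici 1) := setLIntegral_one _
      _ < ⊤ := h.measure_Ici_lt_top one_pos

/-- The tail `lam ((v ^ (d / 2), ∞))` of a Lévy measure on the time scale. -/
def timeTail (d : ℕ) (lam : Measure ℝ) (v : ℝ) : ℝ := (lam (Ioi (v ^ ((d : ℝ) / 2)))).toReal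

theorem IsLevyMeasure.antitoneOn_timeTail {lam : Measure ℝ} (h : IsLevyMeasure lam) (d : ℕ) :
    AntitoneOn (timeTail d lam) (Ioi 0) := by
  intro u hu v hv huv
  have hu0 : (0 : ℝ) < u := hu
  exact ENNReal.toReal_mono (h.measure_Ioi_lt_top (by positivity)).ne
    (measure_mono (Ioi_subset_Ioi (Real.rpow_le_rpow hu0.le huv (by positivity))))

theorem ConditionF.intervalIntegrable_timeTail {d : ℕ} (hd : 1 ≤ d) {lam : Measure ℝ}
    (hF : ConditionF d lam) (h : IsLevyMeasure lam) {x : ℝ} (hx : 0 < x) :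
    IntervalIntegrable (timeTail d lam) volume 0 x := by
  have h1 : IntervalIntegrable (timeTail d lam) volume 0 1 := by
    rw [intervalIntegrable_iff_integrableOn_Ioc_of_le zero_le_one]
    refine integrable_toReal_of_lintegral_ne_top ?_ (hF.lintegral_tail_lt_top hd h).ne
    refine aemeasurable_restrict_of_antitoneOn measurableSet_Ioc fun u hu v hv huv => ?_
    exact measure_mono (Ioi_subset_Ioi (Real.rpow_le_rpow hu.1.le huv (by positivity)))
  refine h1.trans (AntitoneOn.intervalIntegrable ((h.antitoneOn_timeTail d).mono ?_))
  intro v hv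
  exact (lt_min one_pos hx).trans_le hv.1

theorem tauBar_toReal {d : ℕ} (hd : 1 ≤ d) {κ t : ℝ} (hκ : 0 < κ) (ht : 0 < t) {lam : Measure ℝ}
    (h : IsLevyMeasure lam) {r : ℝ} (hr : 0 < r) :
    (tauBar d κ t lam r).toReal = (r ^ ((2 : ℝ) / d) * (2 * π * κ))⁻¹ *
      ∫ v in (0 : ℝ)..r ^ ((2 : ℝ) / d) * (2 * π * κ) * t, timeTail d lam v := by
  have := h.sigmaFinite
  have hd0 : (0 : ℝ) < d := by positivity
  set c := 2 * π * κ with hc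
  have hc0 : 0 < c := by positivity
  set R := r ^ ((2 : ℝ) / d) with hR
  have hR0 : 0 < R := by positivity
  have hRr : R ^ ((d : ℝ) / 2) = r := by
    rw [hR, ← Real.rpow_mul hr.le, div_mul_div_cancel₀ hd0.ne', div_self two_ne_zero, Real.rpow_one]
  have hmeas : MeasurableSet {p : ℝ × ℝ | p.1 ∈ Ioc (0 : ℝ) t ∧ p.2 ∈ Ioi (0 : ℝ) ∧
      r < (c * p.1) ^ (-(d : ℝ) / 2) * p.2} :=
    (measurable_fst measurableSet_Ioc).inter ((measurable_snd measurableSet_Ioi).inter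
      (measurableSet_lt measurable_const
        (((measurable_fst.const_mul c).pow_const _).mul measurable_snd)))
  have hsec : tauBar d κ t lam r =
      ∫⁻ s in Ioc (0 : ℝ) t, lam (Ioi ((R * c * s) ^ ((d : ℝ) / 2))) := by
    rw [tauBar, Measure.prod_apply hmeas, ← lintegral_indicator measurableSet_Ioc]
    congr 1 with s
    by_cases hs : s ∈ Ioc (0 : ℝ) t
    · rw [indicator_of_mem hs]
      have hcs : 0 < c * s := mul_pos hc0 hs.1
      have hcs' : 0 < (c * s) ^ ((d : ℝ) / 2) := by positivity
      congr 1 with z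
      simp only [mem_Ioi, mem_preimage, mem_ofPred_eq, hs, true_and]
      rw [mul_assoc R c s, Real.mul_rpow hR0.le hcs.le, hRr, neg_div, Real.rpow_neg hcs.le,
        inv_mul_eq_div, lt_div_iff₀ hcs']
      exact ⟨fun hz => hz.2, fun hz => ⟨(mul_pos hr hcs').trans hz, hz⟩⟩
    · rw [indicator_of_notMem hs]
      simp only [preimage_ofPred_eq, hs, false_and, ofPred_false, measure_empty]
  have hanti : AntitoneOn (fun s => lam (Ioi ((R * c * s) ^ ((d : ℝ) / 2)))) (Ioc 0 t) := by
    intro u hu v hv huv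
    have hu0 := hu.1
    refine measure_mono (Ioi_subset_Ioi ?_)
    gcongr
  rw [hsec, ← integral_toReal (aemeasurable_restrict_of_antitoneOn measurableSet_Ioc hanti),
    ← intervalIntegral.integral_of_le ht.le]
  · have := intervalIntegral.integral_comp_mul_left (a := 0) (b := t) (timeTail d lam)
      (mul_pos hR0 hc0).ne'
    rwa [mul_zero, smul_eq_mul] at this
  · refine (ae_restrict_iff' measurableSet_Ioc).2 (Eventually.of_forall fun s hs => ?_)
    have := hs.1
    exact h.measure_Ioi_lt_top (by positivity)

/-- The integral of a power-weighted tail on the space scale, on the time scale. -/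
theorem setIntegral_div_eq_timeTail {d : ℕ} (hd : 1 ≤ d) {lam : Measure ℝ} {ℓ : ℝ → ℝ}
    (hrep : ∀ r ≥ (1 : ℝ), (lam (Ioi r)).toReal = ℓ r * r ^ (-((2 : ℝ) / d))) {r : ℝ}
    (hr : 1 ≤ r) :
    ∫ u in Ioc (1 : ℝ) r, ℓ u / u =
      (d : ℝ) / 2 * ∫ v in (1 : ℝ)..r ^ ((2 : ℝ) / d), timeTail d lam v := by
  have hd0 : (0 : ℝ) < d := by positivity
  have hq : 0 < (d : ℝ) / 2 := by positivity
  have hr0 : 0 < r := by positivity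
  have hR1 : 1 ≤ r ^ ((2 : ℝ) / d) := Real.one_le_rpow hr (by positivity)
  have hpart : ∀ (b : ℝ) (f : ℝ → ℝ),
      ∫ v, (Ioc 1 b).indicator f v = ∫ v in Ioi 0, (Ioc 1 b).indicator f v := by
    intro b f
    refine (setIntegral_eq_integral_of_forall_compl_eq_zero fun v hv => ?_).symm
    exact indicator_of_notMem (fun hm => hv (zero_lt_one.trans hm.1)) f
  rw [intervalIntegral.integral_of_le hR1, ← integral_const_mul,
    ← integral_indicator measurableSet_Ioc, ← integral_indicator measurableSet_Ioc,
    hpart, hpart, ← integral_comp_rpow_Ioi_of_pos hq]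
  refine setIntegral_congr_fun measurableSet_Ioi fun v hv => ?_
  have hv0 : (0 : ℝ) < v := hv
  have hmem : v ^ ((d : ℝ) / 2) ∈ Ioc 1 r ↔ v ∈ Ioc 1 (r ^ ((2 : ℝ) / d)) := by
    have h1 : 1 < v ^ ((d : ℝ) / 2) ↔ 1 < v := by
      simpa using Real.rpow_lt_rpow_iff zero_le_one hv0.le hq
    have h2 : v ^ ((d : ℝ) / 2) ≤ r ↔ v ≤ r ^ ((2 : ℝ) / d) := by
      rw [← Real.le_rpow_inv_iff_of_pos hv0.le hr0.le hq, inv_div]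
    rw [mem_Ioc, mem_Ioc, h1, h2]
  by_cases hm : v ∈ Ioc 1 (r ^ ((2 : ℝ) / d))
  · rw [indicator_of_mem hm, indicator_of_mem (hmem.2 hm), timeTail, hrep _ (hmem.2 hm).1.le,
      ← Real.rpow_mul hv0.le, Real.rpow_sub_one hv0.ne', smul_eq_mul]
    have h3 : (d : ℝ) / 2 * -(2 / d) = -1 := by field_simp
    rw [h3, Real.rpow_neg_one]
    have hvq : 0 < v ^ ((d : ℝ) / 2) := by positivity
    field_simp
  · rw [indicator_of_notMem hm, indicator_of_notMem (hmem.not.2 hm), smul_zero]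

theorem timeTail_pos {d : ℕ} {lam : Measure ℝ} (h : IsLevyMeasure lam)
    (hpos : ∀ r ≥ (1 : ℝ), 0 < (lam (Ioi r)).toReal) {v : ℝ} (hv : 0 < v) :
    0 < timeTail d lam v := by
  refine lt_of_lt_of_le ?_ (h.antitoneOn_timeTail d hv (lt_max_of_lt_left hv) (le_max_left v 1))
  exact hpos _ (Real.one_le_rpow (le_max_right _ _) (by positivity))

theorem SlowlyVarying.tendsto_timeTail {d : ℕ} (hd : 1 ≤ d) {lam : Measure ℝ} {ℓ : ℝ → ℝ} {α : ℝ}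
    (hℓ : SlowlyVarying ℓ)
    (hrep : ∀ r ≥ (1 : ℝ), (lam (Ioi r)).toReal = ℓ r * r ^ (-α)) {k : ℝ} (hk : 0 < k) :
    Tendsto (fun x => timeTail d lam (k * x) / timeTail d lam x) atTop
      (𝓝 (k ^ (-((d : ℝ) / 2 * α)))) := by
  have hq : 0 < (d : ℝ) / 2 := by positivity
  have h := ((hℓ.2.2 (k ^ ((d : ℝ) / 2)) (by positivity)).comp (tendsto_rpow_atTop hq)).mul_const
    (k ^ (-((d : ℝ) / 2 * α)))
  rw [one_mul] at h
  refine h.congr' ?_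
  filter_upwards [eventually_ge_atTop 1, eventually_ge_atTop k⁻¹] with x hx1 hx2
  have hx0 : 0 < x := by positivity
  have hkx : 1 ≤ k * x := by rwa [inv_le_iff_one_le_mul₀' hk] at hx2
  rw [timeTail, timeTail, hrep _ (Real.one_le_rpow hkx hq.le), hrep _ (Real.one_le_rpow hx1 hq.le),
    Real.mul_rpow hk.le hx0.le, Real.mul_rpow (by positivity) (by positivity),
    ← Real.rpow_mul hk.le, Function.comp_apply, mul_neg]
  have hxα : 0 < (x ^ ((d : ℝ) / 2)) ^ (-α) := by positivity
  have hl := hℓ.2.1 _ (Real.one_le_rpow hx1 hq.le)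
  field_simp

/-- Lemma 3.2 (ii): under Condition (F), if `λ̄(r) = ℓ(r) r^{-α}` for `r ≥ 1` with
`ℓ` slowly varying and `α ∈ [0, 2/d]`, then `τ̄(r) ~ (2tD^{-α}/(2-dα)) ℓ(r) r^{-α}`
if `α < 2/d`, and if `α = 2/d` and `∫_1^∞ ℓ(u)/u du = ∞` then
`τ̄(r) ~ (2/d)(2πκ)^{-1} L(r) r^{-2/d}` with `L(r) = ∫_1^r ℓ(u)/u du`. -/
theorem stmt_12 (d : ℕ) (hd : 1 ≤ d) (κ t : ℝ) (hκ : 0 < κ) (ht : 0 < t)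
    (lam : Measure ℝ) (hlam : IsLevyMeasure lam) (hF : ConditionF d lam)
    (α : ℝ) (hα0 : 0 ≤ α) (hα1 : α ≤ 2 / (d : ℝ))
    (ℓ : ℝ → ℝ) (hℓ : SlowlyVarying ℓ)
    (hrep : ∀ r ≥ (1 : ℝ), (lam (Set.Ioi r)).toReal = ℓ r * r ^ (-α))
    (D : ℝ) (hD : D = (2 * π * κ * t) ^ ((d : ℝ) / 2)) :
    (α < 2 / (d : ℝ) →
      Tendsto (fun r : ℝ =>
          (tauBar d κ t lam r).toReal /
            (2 * t * D ^ (-α) / (2 - (d : ℝ) * α) * (ℓ r * r ^ (-α))))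
        atTop (𝓝 1)) ∧
    (α = 2 / (d : ℝ) →
      Tendsto (fun r : ℝ => ∫ u in Set.Ioc (1 : ℝ) r, ℓ u / u) atTop atTop →
      Tendsto (fun r : ℝ =>
          (tauBar d κ t lam r).toReal /
            (2 / (d : ℝ) * (2 * π * κ)⁻¹ * (∫ u in Set.Ioc (1 : ℝ) r, ℓ u / u) *
              r ^ (-((2 : ℝ) / d))))
        atTop (𝓝 1)) := by
  have hd0 : (0 : ℝ) < d := by positivity
  have hanti := hlam.antitoneOn_timeTail d
  have hpos : ∀ v > 0, 0 < timeTail d lam v := fun v hv =>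
    timeTail_pos hlam (fun r hr => by
      have h1 := hℓ.2.1 r hr
      have h2 : 0 < r := by positivity
      rw [hrep r hr]; positivity) hv
  have hint : ∀ x > 0, IntervalIntegrable (timeTail d lam) volume 0 x := fun x hx =>
    hF.intervalIntegrable_timeTail hd hlam hx
  have hreg : ∀ k > 0, Tendsto (fun x => timeTail d lam (k * x) / timeTail d lam x) atTop
      (𝓝 (k ^ (-((d : ℝ) / 2 * α)))) := fun k hk => hℓ.tendsto_timeTail hd hrep hk
  have hc : 0 < 2 * π * κ := by positivity
  have hscale : Tendsto (fun r : ℝ => r ^ ((2 : ℝ) / d)) atTop atTop :=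
    tendsto_rpow_atTop (by positivity)
  set k := 2 * π * κ * t with hk
  have hk0 : 0 < k := by positivity
  constructor
  · intro hα
    rw [lt_div_iff₀ hd0] at hα
    set a := (d : ℝ) / 2 * α with ha
    have ha0 : 0 ≤ a := by positivity
    have ha1 : a < 1 := by rw [ha]; linarith
    have hDa : D ^ (-α) = k ^ (-a) := by rw [hD, ← Real.rpow_mul hk0.le, ha, mul_neg]
    have hka : 0 < k ^ (-a) := by positivity
    have h1 := (hanti.tendsto_integral_div_mul_self hpos hint hreg ha0 ha1).comp
      (hscale.const_mul_atTop hk0)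
    have h2 := (hreg k hk0).comp hscale
    have h3 := (h1.mul h2).mul_const ((1 - a) * (k ^ (-a))⁻¹)
    have hlim : 1 / (1 - a) * k ^ (-a) * ((1 - a) * (k ^ (-a))⁻¹) = 1 := by
      have : 1 - a ≠ 0 := by linarith
      field_simp
    rw [hlim] at h3
    refine h3.congr' ?_
    filter_upwards [eventually_ge_atTop 1] with r hr
    have hr0 : 0 < r := by positivity
    have htail : timeTail d lam (r ^ ((2 : ℝ) / d)) = ℓ r * r ^ (-α) := by
      rw [timeTail, ← Real.rpow_mul hr0.le, div_mul_div_cancel₀ hd0.ne', div_self two_ne_zero,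
        Real.rpow_one, hrep r hr]
    have hden : 2 - (d : ℝ) * α = 2 * (1 - a) := by rw [ha]; ring
    have hX : 0 < r ^ ((2 : ℝ) / d) := by positivity
    have hHX := hpos _ hX
    have hHkX := hpos _ (mul_pos hk0 hX)
    rw [tauBar_toReal hd hκ ht hlam hr0, hDa, hden, ← htail, mul_assoc _ (2 * π * κ) t, ← hk,
      mul_comm (r ^ ((2 : ℝ) / d)) k]
    simp only [Function.comp_apply]
    generalize (∫ v in (0 : ℝ)..k * r ^ ((2 : ℝ) / d), timeTail d lam v) = J
    generalize timeTail d lam (k * r ^ ((2 : ℝ) / d)) = h at hHkX ⊢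
    generalize timeTail d lam (r ^ ((2 : ℝ) / d)) = h' at hHX ⊢
    have : 1 - a ≠ 0 := by linarith
    generalize k ^ (-a) = w at hka ⊢
    rw [hk]
    field_simp
  · rintro hα hL
    have ha : (d : ℝ) / 2 * α = 1 := by rw [hα]; field_simp
    rw [ha] at hreg
    subst hα
    have h1 := (hanti.tendsto_integral_mul_div_integral hpos hint hreg hk0).comp hscale
    have h2 : Tendsto (fun r => ∫ v in (1 : ℝ)..r ^ ((2 : ℝ) / d), timeTail d lam v)
        atTop atTop := by
      refine (hL.const_mul_atTop (show 0 < 2 / (d : ℝ) by positivity)).congr' ?_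
      filter_upwards [eventually_ge_atTop 1] with r hr
      rw [setIntegral_div_eq_timeTail hd hrep hr]
      field_simp
    have h3 := (h2.const_div_atTop (∫ v in (0 : ℝ)..1, timeTail d lam v)).add_const 1
    have h4 := h1.mul h3
    rw [zero_add, mul_one] at h4
    refine h4.congr' ?_
    filter_upwards [eventually_ge_atTop 1, h2.eventually_gt_atTop 0] with r hr hJ
    have hr0 : 0 < r := by positivity
    have hX : 0 < r ^ ((2 : ℝ) / d) := by positivity
    have hsplit := intervalIntegral.integral_add_adjacent_intervals (hint 1 one_pos)
      ((hint 1 one_pos).symm.trans (hint _ hX))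
    have hI0 : 0 ≤ ∫ v in (0 : ℝ)..1, timeTail d lam v :=
      intervalIntegral.integral_nonneg zero_le_one fun v _ => ENNReal.toReal_nonneg
    rw [tauBar_toReal hd hκ ht hlam hr0, setIntegral_div_eq_timeTail hd hrep hr,
      mul_assoc _ (2 * π * κ) t, ← hk, mul_comm (r ^ ((2 : ℝ) / d)) k, Real.rpow_neg hr0.le]
    simp only [Function.comp_apply]
    rw [← hsplit]
    generalize (∫ v in (0 : ℝ)..k * r ^ ((2 : ℝ) / d), timeTail d lam v) = J
    generalize (∫ v in (1 : ℝ)..r ^ ((2 : ℝ) / d), timeTail d lam v) = K at hJ ⊢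
    generalize (∫ v in (0 : ℝ)..1, timeTail d lam v) = I at hI0 ⊢
    have : I + K ≠ 0 := by positivity
    field_simp
end
end
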